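/- arXiv:0801.4013 — 6 statements merged into one kernel-verified Lean document; each statement's English description precedes it below -/
import Mathlib

section
/- Let p1, p2, p3 be points in the Euclidean plane with p1 ≠ p2 and p1 ≠ p3, let 0 ≤ θ < π/4, and suppose that the angle ∠p3 p1 p2 is at most θ and that |p1p3| ≤ |p1p2|. Then |p2p3| ≤ |p1p2| − (cos θ − sin θ)·|p1p3|. -/
open EuclideanGeometry Real

theorem yao_lemma (p1 p2 p3 : EuclideanSpace ℝ (Fin 2)) (θ : ℝ)
    (h12 : p1 ≠ p2) (h13 : p1 ≠ p3)
    (hθ0 : 0 ≤ θ) (hθ : θ < Real.pi / 4)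
    (hang : ∠ p3 p1 p2 ≤ θ)
    (hle : dist p1 p3 ≤ dist p1 p2) :
    dist p2 p3 ≤ dist p1 p2 - (Real.cos θ - Real.sin θ) * dist p1 p3 := by
  have hlaw := EuclideanGeometry.law_cos p3 p1 p2
  have hcos : Real.cos θ ≤ Real.cos (∠ p3 p1 p2) :=
    Real.cos_le_cos_of_nonneg_of_le_pi (angle_nonneg _ _ _)
      (by linarith [Real.pi_pos]) hang
  have hs : 0 ≤ Real.sin θ :=
    Real.sin_nonneg_of_nonneg_of_le_pi hθ0 (by linarith [Real.pi_pos])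
  have hc : Real.cos θ ≤ 1 := Real.cos_le_one θ
  have hsc := Real.sin_sq_add_cos_sq θ
  rw [dist_comm p3 p2, dist_comm p3 p1, dist_comm p2 p1] at hlaw
  have hb : 0 ≤ dist p1 p3 := dist_nonneg
  generalize dist p1 p3 = b at *
  generalize dist p1 p2 = a at *
  generalize Real.cos (∠ p3 p1 p2) = k at *
  generalize Real.cos θ = c at *
  generalize Real.sin θ = s at *
  have hcb : c * b ≤ a := (mul_le_of_le_one_left hb hc).trans hle
  have hab : 0 ≤ a * b := mul_nonneg (hb.trans hle) hb
  have hrhs : 0 ≤ a - (c - s) * b := by linarith [mul_nonneg hs hb]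
  refine abs_le_of_sq_le_sq' ?_ hrhs |>.2
  have hk : a * b * c ≤ a * b * k := mul_le_mul_of_nonneg_left hcos hab
  have hbs : b * s * (c * b) ≤ b * s * a :=
    mul_le_mul_of_nonneg_left hcb (mul_nonneg hb hs)
  have hsq : (a - (c - s) * b) ^ 2 =
      a ^ 2 - 2 * (a * b * c) + 2 * (b * s * a) + b ^ 2 - 2 * (b * s * (c * b)) := by
    linear_combination b ^ 2 * hsc
  rw [hsq]
  linarith
end

section
/- Let D1 = (p1,r1), D2 = (p2,r2), D3 = (p3,r3) be pairwise disjoint disks in the plane, and let 0 < θ ≤ 0.228. Suppose the angle ∠p2 p1 p3 is at most θ, that r1 ≤ d(D1,D3), and that d(D1,D3) ≤ d(D1,D2). Then d(D2,D3) ≤ d(D1,D2) − (cos 2θ − sin 2θ − 2 sin(θ/2))·d(D1,D3). -/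
open EuclideanGeometry Real

/-- If `s` is at most both side lengths at the vertex `p1`, then walking from `p2` towards `p1`
until distance `s`, across the chord of the circle of radius `s`, and out to `p3` is at least as
long as the opposite side. -/
theorem dist_le_sub_add_sub_add_chord {V P : Type*} [NormedAddCommGroup V]
    [InnerProductSpace ℝ V] [MetricSpace P] [NormedAddTorsor V P] (p1 p2 p3 : P) {s : ℝ}
    (hs : 0 ≤ s) (h2 : s ≤ dist p1 p2) (h3 : s ≤ dist p1 p3) :
    dist p2 p3 ≤ (dist p1 p2 - s) + (dist p1 p3 - s) + 2 * s * sin (∠ p2 p1 p3 / 2) := by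
  have law := EuclideanGeometry.law_cos p2 p1 p3
  rw [dist_comm p2 p1, dist_comm p3 p1] at law
  have hcos : cos (∠ p2 p1 p3) = 1 - 2 * sin (∠ p2 p1 p3 / 2) ^ 2 := by
    have h := cos_two_mul (∠ p2 p1 p3 / 2)
    rw [mul_div_cancel₀ _ (two_ne_zero' ℝ)] at h
    linarith [sin_sq_add_cos_sq (∠ p2 p1 p3 / 2)]
  have ht0 : 0 ≤ sin (∠ p2 p1 p3 / 2) :=
    sin_nonneg_of_nonneg_of_le_pi (by linarith [angle_nonneg p2 p1 p3])
      (by linarith [angle_nonneg p2 p1 p3, angle_le_pi p2 p1 p3])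
  have ht1 := sin_le_one (∠ p2 p1 p3 / 2)
  rw [hcos] at law
  generalize sin (∠ p2 p1 p3 / 2) = t at *
  obtain ⟨u, hu⟩ : ∃ u, dist p1 p2 = s + u := ⟨_, (add_sub_cancel _ _).symm⟩
  obtain ⟨v, hv⟩ : ∃ v, dist p1 p3 = s + v := ⟨_, (add_sub_cancel _ _).symm⟩
  rw [hu] at h2 law ⊢
  rw [hv] at h3 law ⊢
  have hu0 : 0 ≤ u := by linarith
  have hv0 : 0 ≤ v := by linarith
  have htt : 0 ≤ t * (1 - t) := mul_nonneg ht0 (by linarith)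
  have hut : 0 ≤ 1 - t ^ 2 := by nlinarith
  refine (abs_le_of_sq_le_sq' ?_ ?_).2
  · nlinarith [mul_nonneg (mul_nonneg hu0 hv0) hut,
      mul_nonneg (mul_nonneg hs (add_nonneg hu0 hv0)) htt]
  · simp only [add_sub_cancel_left]
    positivity

theorem two_mul_sin_half_le_sin_two_mul {θ : ℝ} (h0 : 0 ≤ θ) (h1 : θ ≤ 1 / 2) :
    2 * sin (θ / 2) ≤ sin (2 * θ) := by
  have hs : sin θ = 2 * sin (θ / 2) * cos (θ / 2) := by
    rw [← sin_two_mul, mul_div_cancel₀ _ (two_ne_zero' ℝ)]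
  have hc1 : 3 / 4 ≤ cos θ := by nlinarith [one_sub_sq_div_two_le_cos (x := θ)]
  have hc2 : 3 / 4 ≤ cos (θ / 2) := by nlinarith [one_sub_sq_div_two_le_cos (x := θ / 2)]
  have hs0 : 0 ≤ sin (θ / 2) :=
    sin_nonneg_of_nonneg_of_le_pi (by linarith) (by linarith [pi_gt_three])
  have hcc : 1 / 2 ≤ cos (θ / 2) * cos θ := by nlinarith
  rw [sin_two_mul, hs]
  nlinarith [mul_le_mul_of_nonneg_left hcc hs0]

theorem yao_induction_step (p1 p2 p3 : EuclideanSpace ℝ (Fin 2)) (r1 r2 r3 θ : ℝ)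
    (hr1 : 0 < r1) (hr2 : 0 < r2) (hr3 : 0 < r3)
    (h12 : r1 + r2 ≤ dist p1 p2) (h13 : r1 + r3 ≤ dist p1 p3) (h23 : r2 + r3 ≤ dist p2 p3)
    (hθ0 : 0 < θ) (hθ : θ ≤ 0.228)
    (hang : ∠ p2 p1 p3 ≤ θ)
    (hrd : r1 ≤ dist p1 p3 - r1 - r3)
    (hdd : dist p1 p3 - r1 - r3 ≤ dist p1 p2 - r1 - r2) :
    dist p2 p3 - r2 - r3 ≤ (dist p1 p2 - r1 - r2) -
      (Real.cos (2 * θ) - Real.sin (2 * θ) - 2 * Real.sin (θ / 2)) *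
        (dist p1 p3 - r1 - r3) := by
  have hθ' : θ ≤ 1 / 2 := hθ.trans (by norm_num)
  have hchord := dist_le_sub_add_sub_add_chord p1 p2 p3 (s := dist p1 p3 - r3)
    (by linarith) (by linarith) (by linarith)
  have hsin : sin (∠ p2 p1 p3 / 2) ≤ sin (θ / 2) :=
    sin_le_sin_of_le_of_le_pi_div_two (by linarith [angle_nonneg p2 p1 p3, pi_pos])
      (by linarith [pi_gt_three]) (by linarith)
  have hsin0 : 0 ≤ sin (θ / 2) :=
    sin_nonneg_of_nonneg_of_le_pi (by linarith) (by linarith [pi_gt_three])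
  obtain ⟨y, hy⟩ : ∃ y, dist p1 p3 = y + r1 + r3 := ⟨dist p1 p3 - r1 - r3, by ring⟩
  rw [hy] at hrd hchord ⊢
  have hy0 : 0 ≤ y := by linarith
  have hry : 0 ≤ y - r1 := by linarith
  have hcoef : 4 * sin (θ / 2) ≤ 1 - (cos (2 * θ) - sin (2 * θ) - 2 * sin (θ / 2)) := by
    linarith [two_mul_sin_half_le_sin_two_mul hθ0.le hθ', cos_le_one (2 * θ)]
  have hyr : 0 ≤ y + r1 := by linarith
  linarith [mul_le_mul_of_nonneg_left hsin hyr, mul_nonneg hry hsin0,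
    mul_le_mul_of_nonneg_left hcoef hy0]
end

section
/- Let V be a finite set of points in the Euclidean plane, let 𝒱 be a partition of V, let t ≥ 1, and let S be a set of unordered pairs of points of V such that for all u, w ∈ V there exists a finite sequence of points of V from u to w whose consecutive pairs all belong to S and whose total Euclidean length is at most t·|uw|. Then for all parts U, W ∈ 𝒱 there exists a finite sequence of parts U = U_1, …, U_m = W of 𝒱 such that for each consecutive pair (U_i, U_{i+1}) there exist u ∈ U_i and w ∈ U_{i+1} with {u,w} ∈ S, and such that the sum over i of the distances |U_i U_{i+1}| is at most t·|UW|. -/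
abbrev Pt : Type := EuclideanSpace ℝ (Fin 2)

/-- The total Euclidean length of a finite sequence of points. -/
noncomputable def eucLen : List Pt → ℝ
  | [] => 0
  | [_] => 0
  | a :: b :: rest => dist a b + eucLen (b :: rest)

/-- The distance between two (nonempty, finite) sets of points: the minimum
of the pairwise distances. -/
noncomputable def setDist (U W : Finset Pt) : ℝ :=
  sInf {d : ℝ | ∃ u ∈ U, ∃ w ∈ W, d = dist u w}

/-- The sum of the distances between consecutive parts of a sequence of parts. -/
noncomputable def partLen : List (Finset Pt) → ℝ
  | [] => 0
  | [_] => 0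
  | U :: W :: rest => setDist U W + partLen (W :: rest)

theorem setDist_le_dist {U W : Finset Pt} {u w : Pt} (hu : u ∈ U) (hw : w ∈ W) :
    setDist U W ≤ dist u w := by
  refine csInf_le ⟨0, ?_⟩ ⟨u, hu, w, hw, rfl⟩
  rintro d ⟨a, -, b, -, rfl⟩
  exact dist_nonneg

theorem exists_dist_eq_setDist {U W : Finset Pt} (hU : U.Nonempty) (hW : W.Nonempty) :
    ∃ u ∈ U, ∃ w ∈ W, setDist U W = dist u w := by
  have hne : {d : ℝ | ∃ u ∈ U, ∃ w ∈ W, d = dist u w}.Nonempty := by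
    obtain ⟨u, hu⟩ := hU
    obtain ⟨w, hw⟩ := hW
    exact ⟨_, u, hu, w, hw, rfl⟩
  have hfin : {d : ℝ | ∃ u ∈ U, ∃ w ∈ W, d = dist u w}.Finite := by
    refine ((U ×ˢ W).finite_toSet.image fun p => dist p.1 p.2).subset ?_
    rintro d ⟨u, hu, w, hw, rfl⟩
    exact ⟨(u, w), by simp [hu, hw], rfl⟩
  exact hne.csInf_mem hfin

theorem partLen_map_le_eucLen (part : Pt → Finset Pt) :
    ∀ l : List Pt, (∀ x ∈ l, x ∈ part x) → partLen (l.map part) ≤ eucLen l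
  | [], _ => le_rfl
  | [_], _ => le_rfl
  | a :: b :: rest, h => by
    have ih := partLen_map_le_eucLen part (b :: rest) fun x hx => h x (List.mem_cons_of_mem a hx)
    exact add_le_add (setDist_le_dist (h a (by simp)) (h b (by simp))) ih

theorem isChain_map_of_mem_part (part : Pt → Finset Pt) (S : Set (Sym2 Pt)) :
    ∀ l : List Pt, (∀ x ∈ l, x ∈ part x) → l.IsChain (fun a b => s(a, b) ∈ S) →
      (l.map part).IsChain (fun Ui Uj => ∃ u ∈ Ui, ∃ w ∈ Uj, s(u, w) ∈ S)
  | [], _, _ => by simp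
  | [_], _, _ => by simp
  | a :: b :: rest, h, hc => by
    rw [List.isChain_cons_cons] at hc
    have ih := isChain_map_of_mem_part part S (b :: rest)
      (fun x hx => h x (List.mem_cons_of_mem a hx)) hc.2
    simp only [List.map_cons] at ih ⊢
    exact List.isChain_cons_cons.2 ⟨⟨a, h a (by simp), b, h b (by simp), hc.1⟩, ih⟩

theorem quotient_spanner (V : Finset Pt) (𝒱 : Finset (Finset Pt))
    (hpartne : ∀ U ∈ 𝒱, U.Nonempty)
    (hpartdisj : ∀ U ∈ 𝒱, ∀ W ∈ 𝒱, U ≠ W → Disjoint U W)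
    (hpartcover : ∀ x, x ∈ V ↔ ∃ U ∈ 𝒱, x ∈ U)
    (t : ℝ) (ht : 1 ≤ t)
    (S : Set (Sym2 Pt))
    (hspan : ∀ u ∈ V, ∀ w ∈ V,
      ∃ l : List Pt, (∀ x ∈ l, x ∈ V) ∧ l.head? = some u ∧ l.getLast? = some w ∧
        l.Chain' (fun a b => s(a, b) ∈ S) ∧ eucLen l ≤ t * dist u w) :
    ∀ U ∈ 𝒱, ∀ W ∈ 𝒱,
      ∃ L : List (Finset Pt),
        (∀ X ∈ L, X ∈ 𝒱) ∧ L.head? = some U ∧ L.getLast? = some W ∧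
        L.Chain' (fun Ui Uj => ∃ u ∈ Ui, ∃ w ∈ Uj, s(u, w) ∈ S) ∧
        partLen L ≤ t * setDist U W := by
  intro U hU W hW
  obtain ⟨u, hu, w, hw, hd⟩ := exists_dist_eq_setDist (hpartne U hU) (hpartne W hW)
  obtain ⟨l, hlV, hhead, hlast, hchain, hlen⟩ :=
    hspan u ((hpartcover u).2 ⟨U, hU, hu⟩) w ((hpartcover w).2 ⟨W, hW, hw⟩)
  have hpart : ∀ x, ∃ X : Finset Pt, x ∈ V → X ∈ 𝒱 ∧ x ∈ X := by
    intro x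
    by_cases hx : x ∈ V
    · obtain ⟨X, hX⟩ := (hpartcover x).1 hx
      exact ⟨X, fun _ => hX⟩
    · exact ⟨∅, fun h => absurd h hx⟩
  choose part hpart using hpart
  have part_eq : ∀ X ∈ 𝒱, ∀ x ∈ X, part x = X := by
    intro X hX x hx
    obtain ⟨hmem, hxp⟩ := hpart x ((hpartcover x).2 ⟨X, hX, hx⟩)
    by_contra hne
    exact Finset.disjoint_left.1 (hpartdisj _ hmem X hX hne) hxp hx
  have hl : ∀ x ∈ l, x ∈ part x := fun x hx => (hpart x (hlV x hx)).2
  refine ⟨l.map part, ?_, ?_, ?_, isChain_map_of_mem_part part S l hl hchain, ?_⟩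
  · intro X hX
    obtain ⟨x, hx, rfl⟩ := List.mem_map.1 hX
    exact (hpart x (hlV x hx)).1
  · rw [List.head?_map, hhead, Option.map_some, part_eq U hU u hu]
  · rw [List.getLast?_map, hlast, Option.map_some, part_eq W hW w hw]
  · rw [hd]
    exact (partLen_map_le_eucLen part l hl).trans hlen
end

section
/- Let A = (a,r_A) and B = (b,r_B) be disks in the plane with |ab| > r_A + r_B, and let D1 = (c_1,ρ_1) and D2 = (c_2,ρ_2), with ρ_1, ρ_2 ≥ 0, each be tangent to both A and B. If the closed ball D1 is contained in the closed ball D2, then c_1 = c_2 and ρ_1 = ρ_2. -/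
theorem tangent_disk_containment_rigid
    (a b c1 c2 : EuclideanSpace ℝ (Fin 2)) (rA rB ρ1 ρ2 : ℝ)
    (hrA : 0 < rA) (hrB : 0 < rB)
    (hab : rA + rB < dist a b)
    (hρ1 : 0 ≤ ρ1) (hρ2 : 0 ≤ ρ2)
    (h1A : dist c1 a = ρ1 + rA) (h1B : dist c1 b = ρ1 + rB)
    (h2A : dist c2 a = ρ2 + rA) (h2B : dist c2 b = ρ2 + rB)
    (hsub : Metric.closedBall c1 ρ1 ⊆ Metric.closedBall c2 ρ2) :
    c1 = c2 ∧ ρ1 = ρ2 := by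
  by_cases hc : c1 = c2
  · subst hc
    exact ⟨rfl, by linarith⟩
  exfalso
  have hu : c1 - c2 ≠ 0 := sub_ne_zero.mpr hc
  have hd : 0 < ‖c1 - c2‖ := norm_pos_iff.mpr hu
  -- The point of the first disk farthest from `c2` bounds the distance of the centers.
  have hle : ‖c1 - c2‖ + ρ1 ≤ ρ2 := by
    have hmem : c1 + (ρ1 / ‖c1 - c2‖) • (c1 - c2) ∈ Metric.closedBall c1 ρ1 := by
      rw [Metric.mem_closedBall, dist_eq_norm, add_sub_cancel_left, norm_smul,
        Real.norm_of_nonneg (by positivity), div_mul_cancel₀ _ hd.ne']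
    have h := hsub hmem
    have heq : c1 + (ρ1 / ‖c1 - c2‖) • (c1 - c2) - c2
        = (1 + ρ1 / ‖c1 - c2‖) • (c1 - c2) := by module
    rw [Metric.mem_closedBall, dist_eq_norm, heq, norm_smul,
      Real.norm_of_nonneg (by positivity), add_mul, one_mul, div_mul_cancel₀ _ hd.ne'] at h
    exact h
  have hray : ∀ (p : EuclideanSpace ℝ (Fin 2)) (r : ℝ), dist c1 p = ρ1 + r →
      dist c2 p = ρ2 + r → SameRay ℝ (c1 - c2) (p - c1) := by
    intro p r h1 h2
    rw [dist_comm, dist_eq_norm] at h1 h2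
    have heq : c1 - c2 + (p - c1) = p - c2 := by abel
    refine sameRay_iff_norm_add.mpr (le_antisymm (norm_add_le _ _) ?_)
    rw [heq]
    linarith
  have hsame : SameRay ℝ (a - c1) (b - c1) :=
    (hray a rA h1A h2A).symm.trans (hray b rB h1B h2B) fun h => absurd h hu
  have hdist := hsame.norm_sub
  rw [sub_sub_sub_cancel_right, ← dist_eq_norm, ← dist_eq_norm, ← dist_eq_norm,
    dist_comm a c1, dist_comm b c1, h1A, h1B, add_sub_add_left_eq_sub] at hdist
  have habs : |rA - rB| < rA + rB := abs_lt.mpr ⟨by linarith, by linarith⟩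
  linarith
end

section
/- Let A, B, C be disks in the plane such that C is disjoint from A and from B, with |center(C) center(A)| > r_C + r_A and |center(C) center(B)| > r_C + r_B, and with |center(A) center(B)| > r_A + r_B. Then there exists a set R of at most six points of the plane that represents C with respect to A and B: for every disk F = (c,ρ) with ρ ≥ 0 tangent to both A and B, if F ∩ C ≠ ∅ then F ∩ R ≠ ∅. -/
/-- The Lorentzian inner product on `ℝ × ℝ × ℝ`, of signature `(1, 2)`. -/
def lorentz (x y : ℝ × ℝ × ℝ) : ℝ := x.1 * y.1 - x.2.1 * y.2.1 - x.2.2 * y.2.2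

lemma lorentz_add_left (x y z : ℝ × ℝ × ℝ) :
    lorentz (x + y) z = lorentz x z + lorentz y z := by
  simp only [lorentz, Prod.fst_add, Prod.snd_add]; ring

lemma lorentz_smul_left (t : ℝ) (x z : ℝ × ℝ × ℝ) :
    lorentz (t • x) z = t * lorentz x z := by
  simp only [lorentz, Prod.smul_fst, Prod.smul_snd, smul_eq_mul]; ring

lemma lorentz_comm (x y : ℝ × ℝ × ℝ) : lorentz x y = lorentz y x := by
  simp only [lorentz]; ring

lemma lorentz_add_right (x y z : ℝ × ℝ × ℝ) :
    lorentz z (x + y) = lorentz z x + lorentz z y := by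
  simp only [lorentz_comm z, lorentz_add_left]

lemma lorentz_smul_right (t : ℝ) (x z : ℝ × ℝ × ℝ) :
    lorentz z (t • x) = t * lorentz z x := by
  simp only [lorentz_comm z, lorentz_smul_left]

/-- A Lorentz-orthonormal pair of a timelike and a spacelike vector extends to an orthonormal
frame. -/
lemma exists_lorentz_frame (e₀ e₁ : ℝ × ℝ × ℝ) (h₀ : lorentz e₀ e₀ = 1)
    (h₁ : lorentz e₁ e₁ = -1) (h₀₁ : lorentz e₀ e₁ = 0) :
    ∃ w, lorentz w w = -1 ∧ lorentz e₀ w = 0 ∧ lorentz e₁ w = 0 ∧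
      ∀ x, lorentz x x = lorentz e₀ x ^ 2 - lorentz e₁ x ^ 2 - lorentz w x ^ 2 := by
  obtain ⟨a, b, c⟩ := e₀
  obtain ⟨d, e, f⟩ := e₁
  refine ⟨(b * f - c * e, -(c * d - a * f), -(a * e - b * d)), ?_, ?_, ?_, ?_⟩
  · simp only [lorentz] at *
    linear_combination (d * d - e * e - f * f) * h₀ + h₁ - (a * d - b * e - c * f) * h₀₁
  · simp only [lorentz]; ring
  · simp only [lorentz]; ring
  · rintro ⟨x, y, z⟩
    have gram : lorentz (b * f - c * e, -(c * d - a * f), -(a * e - b * d)) (x, y, z) ^ 2 =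
        lorentz (x, y, z) (x, y, z) * (lorentz (a, b, c) (a, b, c) * lorentz (d, e, f) (d, e, f)
          - lorentz (a, b, c) (d, e, f) ^ 2)
        - lorentz (a, b, c) (x, y, z) ^ 2 * lorentz (d, e, f) (d, e, f)
        - lorentz (d, e, f) (x, y, z) ^ 2 * lorentz (a, b, c) (a, b, c)
        + 2 * lorentz (a, b, c) (x, y, z) * lorentz (d, e, f) (x, y, z)
          * lorentz (a, b, c) (d, e, f) := by
      simp only [lorentz]; ring
    rw [h₀, h₁, h₀₁] at gram
    linear_combination gram

/-- Two unit timelike vectors cover all null vectors `x` with `⟪c, x⟫ ≤ ⟪q, x⟫`. -/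
lemma exists_two_unit_timelike (q c : ℝ × ℝ × ℝ) (hq : 0 < lorentz q q) (hq1 : lorentz q q < 1)
    (hc : 0 ≤ lorentz c c) (hcq : 1 + lorentz c c * lorentz q q < 2 * lorentz c q) :
    ∃ y z, lorentz y y = 1 ∧ lorentz z z = 1 ∧ 0 < lorentz y q ∧ 0 < lorentz z q ∧
      ∀ x, lorentz x x = 0 → 0 ≤ lorentz q x → lorentz c x ≤ lorentz q x →
        lorentz y x ≤ lorentz q x ∨ lorentz z x ≤ lorentz q x := by
  obtain ⟨m, hm, hmq⟩ : ∃ m : ℝ, 0 < m ∧ lorentz q q = m ^ 2 :=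
    ⟨√(lorentz q q), Real.sqrt_pos.2 hq, (Real.sq_sqrt hq.le).symm⟩
  have hm1 : m ^ 2 < 1 := hmq ▸ hq1
  obtain ⟨s, hs, hsm⟩ : ∃ s : ℝ, 0 < s ∧ s ^ 2 = 1 - m ^ 2 :=
    ⟨√(1 - m ^ 2), Real.sqrt_pos.2 (by linarith), Real.sq_sqrt (by linarith)⟩
  obtain ⟨C₀, hC₀⟩ : ∃ C₀ : ℝ, lorentz c q = m * C₀ := ⟨lorentz c q / m, by field_simp⟩
  obtain ⟨n, hn⟩ : ∃ n, n = lorentz c c := ⟨_, rfl⟩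
  rw [← hn] at hc
  rw [hmq, ← hn, hC₀] at hcq
  have hC₀pos : 0 < C₀ := by
    have : 0 ≤ n * m ^ 2 := by positivity
    exact pos_of_mul_pos_right (by linarith : 0 < m * C₀) hm.le
  have hgap : (1 - m * C₀) ^ 2 < m ^ 2 * (C₀ ^ 2 - n) := by nlinarith
  have hpos : 0 < C₀ ^ 2 - n :=
    pos_of_mul_pos_right ((sq_nonneg _).trans_lt hgap) (by positivity)
  obtain ⟨C₁, hC₁, hC₁sq⟩ : ∃ C₁ : ℝ, 0 < C₁ ∧ C₁ ^ 2 = C₀ ^ 2 - n :=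
    ⟨√(C₀ ^ 2 - n), Real.sqrt_pos.2 hpos, Real.sq_sqrt hpos.le⟩
  have hsum : 1 < m * (C₀ + C₁) := by
    have : 1 - m * C₀ < m * C₁ := by
      refine lt_of_pow_lt_pow_left₀ 2 (by positivity) ?_
      rw [mul_pow, hC₁sq]; exact hgap
    linarith
  have hle : C₁ ≤ C₀ := by
    refine le_of_sq_le_sq ?_ hC₀pos.le
    linarith
  obtain ⟨e₀, he₀⟩ : ∃ e₀ : ℝ × ℝ × ℝ, e₀ = m⁻¹ • q := ⟨_, rfl⟩
  obtain ⟨e₁, he₁⟩ : ∃ e₁ : ℝ × ℝ × ℝ, e₁ = C₁⁻¹ • (c + (-C₀) • e₀) := ⟨_, rfl⟩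
  have hqe : q = m • e₀ := by rw [he₀, smul_inv_smul₀ hm.ne']
  have hce : c = C₀ • e₀ + C₁ • e₁ := by
    rw [he₁, smul_inv_smul₀ hC₁.ne', neg_smul]; abel
  have h₀ : lorentz e₀ e₀ = 1 := by
    rw [he₀, lorentz_smul_left, lorentz_smul_right, hmq]; field_simp
  have hc₀ : lorentz c e₀ = C₀ := by
    rw [he₀, lorentz_smul_right, hC₀]; field_simp
  have h₀₁ : lorentz e₀ e₁ = 0 := by
    rw [he₁, lorentz_smul_right, lorentz_add_right, lorentz_smul_right, lorentz_comm e₀ c, hc₀, h₀]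
    ring
  have h₁ : lorentz e₁ e₁ = -1 := by
    have h := hn
    rw [hce] at h
    simp only [lorentz_add_left, lorentz_add_right, lorentz_smul_left, lorentz_smul_right, h₀,
      h₀₁, lorentz_comm e₁ e₀] at h
    have : C₁ ^ 2 * lorentz e₁ e₁ = C₁ ^ 2 * (-1) := by linear_combination -h + hC₁sq
    exact mul_left_cancel₀ (by positivity) this
  obtain ⟨w, hw, h₀w, h₁w, hx⟩ := exists_lorentz_frame e₀ e₁ h₀ h₁ h₀₁
  have hm2 : m⁻¹ * m = 1 := inv_mul_cancel₀ hm.ne'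
  refine ⟨m⁻¹ • (e₀ + (s ^ 2) • e₁ + (m * s) • w), m⁻¹ • (e₀ + (s ^ 2) • e₁ + (-(m * s)) • w),
    ?_, ?_, ?_, ?_, ?_⟩
  · simp only [lorentz_add_left, lorentz_add_right, lorentz_smul_left, lorentz_smul_right, h₀,
      h₀₁, h₁, h₀w, h₁w, hw, lorentz_comm e₁ e₀, lorentz_comm w e₀, lorentz_comm w e₁]
    field_simp
    linear_combination (-s ^ 2 - 1) * hsm
  · simp only [lorentz_add_left, lorentz_add_right, lorentz_smul_left, lorentz_smul_right, h₀,
      h₀₁, h₁, h₀w, h₁w, hw, lorentz_comm e₁ e₀, lorentz_comm w e₀, lorentz_comm w e₁]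
    field_simp
    linear_combination (-s ^ 2 - 1) * hsm
  · simp only [hqe, lorentz_add_left, lorentz_smul_left, lorentz_smul_right, h₀,
      h₀₁, h₀w, lorentz_comm e₁ e₀, lorentz_comm w e₀]
    simp [hm.ne']
  · simp only [hqe, lorentz_add_left, lorentz_smul_left, lorentz_smul_right, h₀,
      h₀₁, h₀w, lorentz_comm e₁ e₀, lorentz_comm w e₀]
    simp [hm.ne']
  · intro x hxx hqx hcx
    have hfr := hx x
    rw [hxx] at hfr
    rw [hce, hqe] at hcx
    rw [hqe] at hqx
    simp only [hqe, lorentz_add_left, lorentz_smul_left] at hcx hqx ⊢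
    generalize lorentz e₀ x = f₀ at *
    generalize lorentz e₁ x = g at *
    generalize lorentz w x = v at *
    have hf₀ : 0 ≤ f₀ := nonneg_of_mul_nonneg_right hqx hm
    have habs : |g| ≤ f₀ := abs_le_of_sq_le_sq (by nlinarith [sq_nonneg v]) hf₀
    have hg := abs_le.1 habs
    have hcos : (1 - 2 * m ^ 2) * f₀ ≤ -g := by
      have h1 : C₁ * (1 - 2 * m ^ 2) ≤ C₀ - m := by
        linarith [mul_nonneg (sub_nonneg.2 hle) (sub_nonneg.2 hm1.le),
          mul_lt_mul_of_pos_left hsum hm]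
      have h2 := mul_le_mul_of_nonneg_right h1 hf₀
      refine le_of_mul_le_mul_left ?_ hC₁
      linarith
    have hv : s * (f₀ + g) ≤ m * |v| := by
      refine le_of_sq_le_sq ?_ (by positivity)
      rw [mul_pow, mul_pow, sq_abs, hsm]
      have : 0 ≤ (f₀ + g) * (-g - (1 - 2 * m ^ 2) * f₀) :=
        mul_nonneg (by linarith) (by linarith)
      nlinarith
    have key : ∀ t : ℝ, s * (f₀ + g) ≤ m * -t →
        m⁻¹ * (f₀ + s ^ 2 * g + m * s * t) ≤ m * f₀ := by
      intro t ht
      rw [inv_mul_le_iff₀ hm]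
      nlinarith [mul_le_mul_of_nonneg_left ht hs.le]
    rcases le_total 0 v with h | h
    · right
      rw [abs_of_nonneg h] at hv
      have := key (-v) (by simpa using hv)
      simpa using this
    · left
      rw [abs_of_nonpos h] at hv
      exact key v hv

/-- A unit timelike vector having positive product with a future-pointing timelike vector has time
coordinate at least one. -/
lemma one_le_fst_of_lorentz_pos {y q : ℝ × ℝ × ℝ} (hy : lorentz y y = 1) (hq : 0 < lorentz q q)
    (hq₀ : 0 < q.1) (hyq : 0 < lorentz y q) : 1 ≤ y.1 := by
  obtain ⟨a, b, c⟩ := y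
  obtain ⟨d, e, f⟩ := q
  simp only [lorentz] at *
  by_contra! h
  have ha : a ≤ 0 := by
    by_contra! h'
    nlinarith [sq_nonneg b, sq_nonneg c]
  have h1 : (b * e + c * f) ^ 2 ≤ (a * d) ^ 2 := by
    have h2 : (b * e + c * f) ^ 2 ≤ (b ^ 2 + c ^ 2) * (e ^ 2 + f ^ 2) := by
      nlinarith [sq_nonneg (b * f - c * e)]
    have h3 : (b ^ 2 + c ^ 2) * (e ^ 2 + f ^ 2) ≤ a ^ 2 * d ^ 2 :=
      mul_le_mul (by nlinarith) (by nlinarith) (by positivity) (by positivity)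
    nlinarith
  have h4 : |b * e + c * f| ≤ -(a * d) :=
    abs_le_of_sq_le_sq (by linarith) (by nlinarith)
  linarith [(abs_le.1 h4).1]

lemma dist_sq_eq_coords (x y : Pt) : dist x y ^ 2 = (x 0 - y 0) ^ 2 + (x 1 - y 1) ^ 2 := by
  rw [EuclideanSpace.dist_eq, Real.sq_sqrt (by positivity)]
  simp [Fin.sum_univ_two, Real.dist_eq, sq_abs]

/-- The point of the exterior of the disk `(a, r)` with hyperboloid coordinates `y`. -/
noncomputable def hyperboloidPoint (a : Pt) (r : ℝ) (y : ℝ × ℝ × ℝ) : Pt :=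
  !₂[a 0 + r / (y.1 - 1) * y.2.1, a 1 + r / (y.1 - 1) * y.2.2]

lemma dist_hyperboloidPoint_le {a f : Pt} {r ρ : ℝ} {y : ℝ × ℝ × ℝ} (hr : 0 < r) (hρ : 0 ≤ ρ)
    (hf : dist f a = ρ + r) (hy : lorentz y y = 1) (hy1 : 1 ≤ y.1)
    (h : lorentz y (ρ + r, f 0 - a 0, f 1 - a 1) ≤ ρ) :
    dist f (hyperboloidPoint a r y) ≤ ρ := by
  obtain ⟨t, u, v⟩ := y
  refine le_of_sq_le_sq ?_ hρ
  have hfa := dist_sq_eq_coords f a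
  rw [hf] at hfa
  rw [dist_sq_eq_coords]
  simp only [lorentz, hyperboloidPoint] at *
  have ht : 0 < t - 1 := by
    rcases hy1.lt_or_eq with h1 | h1
    · linarith
    · have hu : u = 0 := by nlinarith [sq_nonneg v]
      have hv : v = 0 := by nlinarith [sq_nonneg u]
      subst hu hv h1
      linarith
  obtain ⟨k, hk⟩ : ∃ k, k = r / (t - 1) := ⟨_, rfl⟩
  have hkp : 0 < k := hk ▸ div_pos hr ht
  have hkt : k * (t - 1) = r := by rw [hk]; field_simp
  simp only [← hk]
  simp only [Matrix.cons_val_zero, Matrix.cons_val_one]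
  have hid : ρ ^ 2 - ((f 0 - (a 0 + k * u)) ^ 2 + (f 1 - (a 1 + k * v)) ^ 2) =
      2 * k * (ρ - (t * (ρ + r) - u * (f 0 - a 0) - v * (f 1 - a 1))) := by
    linear_combination hfa + k ^ 2 * hy + (2 * ρ + r - k * (t + 1)) * hkt
  have : 0 ≤ 2 * k * (ρ - (t * (ρ + r) - u * (f 0 - a 0) - v * (f 1 - a 1))) :=
    mul_nonneg (by positivity) (sub_nonneg.2 h)
  linarith

/-- Hyperboloid representative of the disk `(p, s)` relative to the disk `(a, r)`. -/
noncomputable def diskVector (a : Pt) (r : ℝ) (p : Pt) (s : ℝ) : ℝ × ℝ × ℝ :=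
  (1 + 2 * r * (r - s) / (dist p a ^ 2 - (r - s) ^ 2),
    2 * r * (p 0 - a 0) / (dist p a ^ 2 - (r - s) ^ 2),
    2 * r * (p 1 - a 1) / (dist p a ^ 2 - (r - s) ^ 2))

theorem six_point_representation
    (a b c : Pt) (rA rB rC : ℝ)
    (hrA : 0 < rA) (hrB : 0 < rB) (hrC : 0 < rC)
    (hCA : rC + rA < dist c a) (hCB : rC + rB < dist c b)
    (hAB : rA + rB < dist a b) :
    ∃ R : Finset Pt, R.card ≤ 6 ∧
      ∀ (f : Pt) (ρ : ℝ), 0 ≤ ρ →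
        dist f a = ρ + rA → dist f b = ρ + rB →
        (Metric.closedBall f ρ ∩ Metric.closedBall c rC).Nonempty →
        (Metric.closedBall f ρ ∩ (R : Set Pt)).Nonempty := by
  have hsep : ∀ (p : Pt) (s : ℝ), 0 < s → rA + s < dist p a →
      4 * rA * s < dist p a ^ 2 - (rA - s) ^ 2 := by
    intro p s hs h
    nlinarith
  have hK := hsep b rB hrB (by rwa [dist_comm])
  have hP := hsep c rC hrC (by linarith)
  have hK0 : 0 < dist b a ^ 2 - (rA - rB) ^ 2 := lt_trans (by positivity) hK
  have hP0 : 0 < dist c a ^ 2 - (rA - rC) ^ 2 := lt_trans (by positivity) hP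
  have hself : ∀ (p : Pt) (s : ℝ), 0 < dist p a ^ 2 - (rA - s) ^ 2 →
      lorentz (diskVector a rA p s) (diskVector a rA p s) =
        1 - 4 * rA * s / (dist p a ^ 2 - (rA - s) ^ 2) := by
    intro p s h
    have hd := dist_sq_eq_coords p a
    simp only [lorentz, diskVector]
    generalize hk : dist p a ^ 2 - (rA - s) ^ 2 = k at *
    field_simp
    linear_combination 4 * rA ^ 2 * hd - 4 * rA ^ 2 * hk
  have hlt : ∀ (p : Pt) (s : ℝ), 4 * rA * s < dist p a ^ 2 - (rA - s) ^ 2 →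
      0 < dist p a ^ 2 - (rA - s) ^ 2 →
      0 < lorentz (diskVector a rA p s) (diskVector a rA p s) := by
    intro p s h h'
    rw [hself p s h', sub_pos, div_lt_one h']
    exact h
  have hprod : ∀ (f p : Pt) (s ρ : ℝ), 0 < dist p a ^ 2 - (rA - s) ^ 2 → dist f a = ρ + rA →
      lorentz (diskVector a rA p s) (ρ + rA, f 0 - a 0, f 1 - a 1) =
        ρ + rA * (dist f p ^ 2 - (ρ + s) ^ 2) / (dist p a ^ 2 - (rA - s) ^ 2) := by
    intro f p s ρ h hf
    have h1 := dist_sq_eq_coords f a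
    have h2 := dist_sq_eq_coords p a
    have h3 := dist_sq_eq_coords f p
    rw [hf] at h1
    simp only [lorentz, diskVector]
    generalize hk : dist p a ^ 2 - (rA - s) ^ 2 = k at *
    field_simp
    rw [h3]
    rw [h2] at hk
    linear_combination rA * h1 - rA * hk
  have hQQ := hlt b rB hK hK0
  have hQ1 : lorentz (diskVector a rA b rB) (diskVector a rA b rB) < 1 := by
    rw [hself b rB hK0]
    have : 0 < 4 * rA * rB / (dist b a ^ 2 - (rA - rB) ^ 2) := by positivity
    linarith
  have hCQ : 1 + lorentz (diskVector a rA c rC) (diskVector a rA c rC) *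
      lorentz (diskVector a rA b rB) (diskVector a rA b rB) <
        2 * lorentz (diskVector a rA c rC) (diskVector a rA b rB) := by
    have hid : 2 * lorentz (diskVector a rA c rC) (diskVector a rA b rB) -
        (1 + lorentz (diskVector a rA c rC) (diskVector a rA c rC) *
          lorentz (diskVector a rA b rB) (diskVector a rA b rB)) =
        4 * rA ^ 2 * (dist c b ^ 2 - (rC + rB) ^ 2) /
          ((dist c a ^ 2 - (rA - rC) ^ 2) * (dist b a ^ 2 - (rA - rB) ^ 2)) := by
      rw [hself b rB hK0, hself c rC hP0]
      have h1 := dist_sq_eq_coords c a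
      have h2 := dist_sq_eq_coords b a
      have h3 := dist_sq_eq_coords c b
      simp only [lorentz, diskVector]
      rw [h3]
      generalize hk : dist b a ^ 2 - (rA - rB) ^ 2 = k at *
      generalize hp : dist c a ^ 2 - (rA - rC) ^ 2 = p at *
      rw [h1] at hp
      rw [h2] at hk
      field_simp
      linear_combination -4 * rA ^ 2 * hk - 4 * rA ^ 2 * hp
    have : 0 < dist c b ^ 2 - (rC + rB) ^ 2 := by nlinarith
    have : 0 < 4 * rA ^ 2 * (dist c b ^ 2 - (rC + rB) ^ 2) /
          ((dist c a ^ 2 - (rA - rC) ^ 2) * (dist b a ^ 2 - (rA - rB) ^ 2)) := by positivity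
    linarith
  have hQ0 : 0 < (diskVector a rA b rB).1 := by
    simp only [diskVector]
    have : 1 + 2 * rA * (rA - rB) / (dist b a ^ 2 - (rA - rB) ^ 2) =
        (dist b a ^ 2 + rA ^ 2 - rB ^ 2) / (dist b a ^ 2 - (rA - rB) ^ 2) := by
      field_simp; ring
    rw [this]
    exact div_pos (by nlinarith) hK0
  obtain ⟨y, z, hy, hz, hyq, hzq, hcover⟩ :=
    exists_two_unit_timelike _ _ hQQ hQ1 (hlt c rC hP hP0).le hCQ
  classical
  refine ⟨{hyperboloidPoint a rA y, hyperboloidPoint a rA z},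
    Finset.card_le_two.trans (by norm_num), ?_⟩
  rintro f ρ hρ hfa hfb ⟨x, hxf, hxc⟩
  have hfc : dist f c ≤ ρ + rC := by
    have := dist_triangle f x c
    rw [Metric.mem_closedBall] at hxf hxc
    rw [dist_comm] at hxf
    linarith
  have hnull : lorentz (ρ + rA, f 0 - a 0, f 1 - a 1) (ρ + rA, f 0 - a 0, f 1 - a 1) = 0 := by
    have := dist_sq_eq_coords f a
    rw [hfa] at this
    simp only [lorentz]
    linear_combination this
  have hq : lorentz (diskVector a rA b rB) (ρ + rA, f 0 - a 0, f 1 - a 1) = ρ := by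
    rw [hprod f b rB ρ hK0 hfa, hfb]; simp
  have hc : lorentz (diskVector a rA c rC) (ρ + rA, f 0 - a 0, f 1 - a 1) ≤ ρ := by
    rw [hprod f c rC ρ hP0 hfa]
    have h1 : dist f c ^ 2 - (ρ + rC) ^ 2 ≤ 0 := by nlinarith [dist_nonneg (x := f) (y := c)]
    have h2 := div_nonpos_of_nonpos_of_nonneg
      (mul_nonpos_of_nonneg_of_nonpos hrA.le h1) hP0.le
    linarith
  have := hcover _ hnull (by rw [hq]; exact hρ) (by rw [hq]; exact hc)
  rw [hq] at this
  rcases this with h | h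
  · refine ⟨hyperboloidPoint a rA y, ?_, by simp⟩
    rw [Metric.mem_closedBall, dist_comm]
    exact dist_hyperboloidPoint_le hrA hρ hfa hy (one_le_fst_of_lorentz_pos hy hQQ hQ0 hyq) h
  · refine ⟨hyperboloidPoint a rA z, ?_, by simp⟩
    rw [Metric.mem_closedBall, dist_comm]
    exact dist_hyperboloidPoint_le hrA hρ hfa hz (one_le_fst_of_lorentz_pos hz hQQ hQ0 hzq) h
end

section
/- Let A = (a,r_A) and B = (b,r_B) be disks in the plane with |ab| ≥ r_A + r_B, and let C = (c,r_C) be a disk whose closed ball intersects both the closed ball A and the closed ball B. Then there exists a disk G = (g,ρ) with ρ ≥ 0 such that the closed ball of center g and radius ρ is contained in the closed ball C, and G is tangent to both A and B, i.e., |ga| = ρ + r_A and |gb| = ρ + r_B. -/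
/-- Some point of the segment from `c` to `a` is equidistant from two balls around `a` and `b`
with disjoint interiors, provided `c` is at least as close to the ball around `b`. -/
lemma exists_dist_add_dist_eq_and_dist_sub_eq {E : Type*} [NormedAddCommGroup E] [NormedSpace ℝ E]
    {a b c : E} {rA rB : ℝ} (hrA : 0 ≤ rA) (hab : rA + rB ≤ dist a b)
    (h : dist c b - rB ≤ dist c a - rA) :
    ∃ g : E, dist g c + dist g a = dist c a ∧ dist g a - rA = dist g b - rB := by
  let γ : ℝ → E := AffineMap.lineMap c a
  have hγ : Continuous γ := AffineMap.lineMap_continuous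
  have hcont : Continuous fun t ↦ dist (γ t) b - rB - (dist (γ t) a - rA) := by fun_prop
  obtain ⟨t, ht, hteq⟩ := intermediate_value_Icc zero_le_one hcont.continuousOn
    (show (0 : ℝ) ∈ Set.Icc _ _ by
      simp only [γ, AffineMap.lineMap_apply_zero, AffineMap.lineMap_apply_one, dist_self,
        Set.mem_Icc]
      constructor <;> linarith)
  refine ⟨γ t, ?_, by linarith⟩
  simp only [γ, dist_lineMap_left, dist_lineMap_right, Real.norm_eq_abs, abs_of_nonneg ht.1,
    abs_of_nonneg (sub_nonneg.2 ht.2)]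
  ring

/-- The conclusion of `tangent_disk_inside_common_intersector` in any real normed space, when the
center `c` is at least as close to the ball around `b` as to the ball around `a`. -/
lemma exists_tangent_closedBall_subset {E : Type*} [NormedAddCommGroup E] [NormedSpace ℝ E]
    {a b c : E} {rA rB rC : ℝ} (hrA : 0 ≤ rA) (hab : rA + rB ≤ dist a b)
    (hca : dist c a ≤ rC + rA) (h : dist c b - rB ≤ dist c a - rA) :
    ∃ (g : E) (ρ : ℝ), 0 ≤ ρ ∧ Metric.closedBall g ρ ⊆ Metric.closedBall c rC ∧
      dist g a = ρ + rA ∧ dist g b = ρ + rB := by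
  obtain ⟨g, hg, heq⟩ := exists_dist_add_dist_eq_and_dist_sub_eq hrA hab h
  have := dist_triangle_left a b g
  exact ⟨g, dist g a - rA, by linarith, Metric.closedBall_subset_closedBall' (by linarith),
    by ring, by linarith⟩

theorem tangent_disk_inside_common_intersector
    (a b c : EuclideanSpace ℝ (Fin 2)) (rA rB rC : ℝ)
    (hrA : 0 < rA) (hrB : 0 < rB) (hrC : 0 < rC)
    (hab : rA + rB ≤ dist a b)
    (hCA : (Metric.closedBall c rC ∩ Metric.closedBall a rA).Nonempty)
    (hCB : (Metric.closedBall c rC ∩ Metric.closedBall b rB).Nonempty) :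
    ∃ (g : EuclideanSpace ℝ (Fin 2)) (ρ : ℝ), 0 ≤ ρ ∧
      Metric.closedBall g ρ ⊆ Metric.closedBall c rC ∧
      dist g a = ρ + rA ∧ dist g b = ρ + rB := by
  have hca := Metric.dist_le_add_of_nonempty_closedBall_inter_closedBall hCA
  have hcb := Metric.dist_le_add_of_nonempty_closedBall_inter_closedBall hCB
  rcases le_total (dist c b - rB) (dist c a - rA) with h | h
  · exact exists_tangent_closedBall_subset hrA.le hab hca h
  · rw [add_comm, dist_comm] at hab
    obtain ⟨g, ρ, hρ, hsub, hb, ha⟩ := exists_tangent_closedBall_subset hrB.le hab hcb h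
    exact ⟨g, ρ, hρ, hsub, ha, hb⟩
end
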